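/- Let G be a connected finite simple graph and let S be the set of simplicial vertices of G. If the set V(G) \ S of non-simplicial vertices is nonempty, then the subgraph of G induced on V(G) \ S is connected. -/

import Mathlib

open SimpleGraph

/-- A proper colouring `c` of `G` is distinguishing if the identity is the only
automorphism of `G` preserving `c`. -/
def SimpleGraph.IsDistinguishingColoring {V α : Type*} (G : SimpleGraph V)
    (c : G.Coloring α) : Prop :=
  ∀ φ : G ≃g G, (∀ v, c (φ v) = c v) → ∀ v, φ v = v

/-- The distinguishing chromatic number of `G`: the least `k` such that `G` has a
proper vertex colouring with `k` colours preserved only by the identity automorphism. -/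
noncomputable def SimpleGraph.distChromNum {V : Type*} (G : SimpleGraph V) : ℕ :=
  sInf {k | ∃ c : G.Coloring (Fin k), G.IsDistinguishingColoring c}

/-- The maximum degree of `G`, stated without decidability assumptions. -/
noncomputable def SimpleGraph.maxDeg {V : Type*} [Fintype V] (G : SimpleGraph V) : ℕ := by
  classical exact G.maxDegree

/-- `G` contains no induced subgraph isomorphic to `H`. -/
def SimpleGraph.IsFreeOf {V W : Type*} (G : SimpleGraph V) (H : SimpleGraph W) : Prop :=
  ¬ Nonempty (H ↪g G)

/-- A vertex is simplicial if its neighbourhood is a clique. -/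
def SimpleGraph.IsSimplicialVertex {V : Type*} (G : SimpleGraph V) (v : V) : Prop :=
  G.IsClique (G.neighborSet v)

theorem reach_aux {V : Type*} (G : SimpleGraph V) (n : ℕ) :
    ∀ (u v : V) (hu : ¬ G.IsSimplicialVertex u) (hv : ¬ G.IsSimplicialVertex v)
      (p : G.Walk u v), p.length = n →
      (G.induce {v : V | ¬ G.IsSimplicialVertex v}).Reachable ⟨u, hu⟩ ⟨v, hv⟩ := by
  induction n using Nat.strong_induction_on with
  | _ n ih =>
    intro u v hu hv p hp
    cases p with
    | nil => exact Reachable.refl _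
    | @cons _ w _ huw q =>
      by_cases hw : G.IsSimplicialVertex w
      · cases q with
        | nil => exact absurd hw hv
        | @cons _ x _ hwx r =>
          simp only [Walk.length_cons] at hp
          by_cases hux : u = x
          · subst hux
            exact ih r.length (by omega) u v hu hv r rfl
          · have hadj : G.Adj u x := hw huw.symm hwx hux
            exact ih (r.length + 1) (by omega) u v hu hv (Walk.cons hadj r) (by simp)
      · simp only [Walk.length_cons] at hp
        have h1 := ih q.length (by omega) w v hw hv q rfl
        have h2 : (G.induce {v : V | ¬ G.IsSimplicialVertex v}).Adj ⟨u, hu⟩ ⟨w, hw⟩ := huw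
        exact h2.reachable.trans h1

theorem statement_2 {V : Type*} [Fintype V] (G : SimpleGraph V)
    (hconn : G.Connected)
    (hne : {v : V | ¬ G.IsSimplicialVertex v}.Nonempty) :
    (G.induce {v : V | ¬ G.IsSimplicialVertex v}).Connected := by
  obtain ⟨a, ha⟩ := hne
  haveI : Nonempty {v : V | ¬ G.IsSimplicialVertex v} := ⟨⟨a, ha⟩⟩
  refine ⟨?_⟩
  rintro ⟨u, hu⟩ ⟨v, hv⟩
  obtain ⟨p⟩ := hconn.preconnected u v
  exact reach_aux G p.length u v hu hv p rfl
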